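/- arXiv:1203.1429 — 4 statements merged into one kernel-verified Lean document; each statement's English description precedes it below -/
import Mathlib

section
/- Let K ⊆ ℝⁿ be a compact convex set with vol(K) > 0, let S : ℝⁿ → ℝˢ be a surjective linear map with s ≤ n, and let μ be the pushforward under S of the uniform probability measure on K. Then μ is a log-concave measure: for all compact sets A, B ⊆ ℝˢ and all α ∈ [0,1], μ(α·A + (1−α)·B) ≥ μ(A)^α · μ(B)^{1−α}, where α·A + (1−α)·B denotes the Minkowski sum {α a + (1−α) b : a ∈ A, b ∈ B}. (Theorem 1(ii).) -/
open MeasureTheory Pointwise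

lemma bm_compact {A B : Set ℝ} (hA : IsCompact A) (hB : IsCompact B) (hA' : A.Nonempty)
    (hB' : B.Nonempty) : volume A + volume B ≤ volume (A + B) := by
  obtain ⟨a, ha, ham⟩ := hA.exists_isGreatest hA'
  obtain ⟨b, hb, hbm⟩ := hB.exists_isLeast hB'
  have h1 : volume ((fun x => b + x) '' A) = volume A := by
    rw [Set.image_add_left, measure_preimage_add]
  have h2 : volume ((fun x => a + x) '' B) = volume B := by
    rw [Set.image_add_left, measure_preimage_add]
  rw [← h1, ← h2, ← measure_union₀]
  · apply measure_mono
    rintro x (⟨y, hy, rfl⟩ | ⟨y, hy, rfl⟩)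
    · exact ⟨y, hy, b, hb, by simp [add_comm]⟩
    · exact ⟨a, ha, y, hy, rfl⟩
  · exact ((hB.image (by fun_prop)).measurableSet).nullMeasurableSet
  · refine measure_mono_null (t := {a + b}) ?_ (by simp)
    rintro x ⟨⟨y, hy, rfl⟩, ⟨z, hz, hzz⟩⟩
    have := ham hy
    have := hbm hz
    simp only [Set.mem_singleton_iff] at *
    linarith

lemma bm_meas {A B C : Set ℝ} (hA : MeasurableSet A) (hB : MeasurableSet B) (hA' : A.Nonempty)
    (hB' : B.Nonempty) (h : A + B ⊆ C) : volume A + volume B ≤ volume C := by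
  obtain ⟨a, ha⟩ := hA'
  obtain ⟨b, hb⟩ := hB'
  have key : ∀ K L : Set ℝ, K ⊆ A → L ⊆ B → IsCompact K → IsCompact L →
      volume K + volume L ≤ volume C := by
    intro K L hK hL hKc hLc
    calc volume K + volume L ≤ volume (insert a K) + volume (insert b L) := by
          gcongr <;> exact Set.subset_insert _ _
      _ ≤ volume (insert a K + insert b L) :=
          bm_compact (hKc.insert a) (hLc.insert b) (Set.insert_nonempty _ _)
            (Set.insert_nonempty _ _)
      _ ≤ volume C := measure_mono ((Set.add_subset_add (Set.insert_subset ha hK)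
            (Set.insert_subset hb hL)).trans h)
  rw [hA.measure_eq_iSup_isCompact, hB.measure_eq_iSup_isCompact]
  have fl : ∀ U : Set ℝ, (⨆ (K) (_ : K ⊆ U) (_ : IsCompact K), volume K) =
      ⨆ (K) (_ : K ⊆ U ∧ IsCompact K), volume K := fun U => by
    congr 1; ext K; rw [iSup_and]
  rw [fl, fl]
  refine ENNReal.biSup_add_biSup_le' ⟨∅, by simp⟩ ⟨∅, by simp⟩ ?_
  intro K hK L hL
  exact key K L hK.1 hL.1 hK.2 hL.2

lemma bm_scaled {A B C : Set ℝ} (hA : MeasurableSet A) (hB : MeasurableSet B) (hA' : A.Nonempty)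
    (hB' : B.Nonempty) {a b : ℝ} (ha : 0 < a) (hb : 0 < b)
    (h : ∀ x ∈ A, ∀ y ∈ B, a * x + b * y ∈ C) :
    ENNReal.ofReal a * volume A + ENNReal.ofReal b * volume B ≤ volume C := by
  have := bm_meas (A := a • A) (B := b • B) (C := C) (hA.const_smul₀ a) (hB.const_smul₀ b)
    (hA'.smul_set) (hB'.smul_set) (by
      rintro _ ⟨_, ⟨x, hx, rfl⟩, _, ⟨y, hy, rfl⟩, rfl⟩
      exact h x hx y hy)
  simpa [Measure.addHaar_smul, abs_of_pos ha, abs_of_pos hb] using this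

lemma layer {f : ℝ → ENNReal} (hf : Measurable f) (h1 : ∀ x, f x ≤ 1) :
    ∫⁻ x, f x = ∫⁻ t in Set.Ioo (0:ℝ) 1, volume {x | ENNReal.ofReal t < f x} := by
  have e : ∫⁻ x, f x = ∫⁻ x, ENNReal.ofReal (f x).toReal := by
    congr 1; ext x
    rw [ENNReal.ofReal_toReal ((h1 x).trans_lt ENNReal.one_lt_top).ne]
  rw [e, lintegral_eq_lintegral_meas_lt _ (Filter.Eventually.of_forall fun x => by simp)
    hf.ennreal_toReal.aemeasurable, ← Set.Ioo_union_Ici_eq_Ioi (zero_lt_one' ℝ),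
    lintegral_union measurableSet_Ici (by
      rw [Set.disjoint_left]; intro x hx hx'; exact absurd hx.2 (not_lt.2 hx'))]
  have z : ∫⁻ t in Set.Ici (1:ℝ), volume {x | t < (f x).toReal} = 0 := by
    rw [setLIntegral_congr_fun (g := 0) measurableSet_Ici]
    · simp
    · intro t ht
      have : {x | t < (f x).toReal} = ∅ := by
        ext x
        simp only [Set.mem_ofPred_eq, Set.mem_empty_iff_false, iff_false, not_lt]
        exact (ENNReal.toReal_mono ENNReal.one_ne_top (h1 x)).trans (by simpa using ht)
      simp [this]
  rw [z, add_zero]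
  refine setLIntegral_congr_fun measurableSet_Ioo ?_
  intro t ht
  dsimp only
  congr 1; ext x
  simp only [Set.mem_ofPred_eq]
  rw [ENNReal.ofReal_lt_iff_lt_toReal ht.1.le ((h1 x).trans_lt ENNReal.one_lt_top).ne]

lemma amgm (x y : ENNReal) {a b : ℝ} (ha : 0 < a) (hb : 0 < b) (hab : a + b = 1) :
    x ^ a * y ^ b ≤ ENNReal.ofReal a * x + ENNReal.ofReal b * y := by
  by_cases hx : x = ⊤
  · simp [hx, ENNReal.mul_top, ha]
  by_cases hy : y = ⊤
  · simp [hy, ENNReal.mul_top, hb]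
  lift x to NNReal using hx
  lift y to NNReal using hy
  lift a to NNReal using ha.le
  lift b to NNReal using hb.le
  rw [← ENNReal.coe_rpow_of_nonneg _ ha.le, ← ENNReal.coe_rpow_of_nonneg _ hb.le]
  simp only [ENNReal.ofReal_coe_nnreal]
  exact_mod_cast NNReal.geom_mean_le_arith_mean2_weighted a b x y (by exact_mod_cast hab)

lemma pl_one_normalized {f g h : ℝ → ENNReal} (hf : Measurable f) (hg : Measurable g)
    (hh : Measurable h) {a b : ℝ} (ha : 0 < a) (hb : 0 < b) (hab : a + b = 1)
    (hf1 : ∀ x, f x ≤ 1) (hg1 : ∀ x, g x ≤ 1) (hf2 : ∀ t < 1, ∃ x, t < f x)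
    (hg2 : ∀ t < 1, ∃ x, t < g x)
    (H : ∀ x y, f x ^ a * g y ^ b ≤ h (a * x + b * y)) :
    (∫⁻ x, f x) ^ a * (∫⁻ x, g x) ^ b ≤ ∫⁻ x, h x := by
  refine (amgm _ _ ha hb hab).trans ?_
  have hmin : ∫⁻ x, min (h x) 1 ≤ ∫⁻ x, h x := lintegral_mono fun x => min_le_left _ _
  refine le_trans ?_ hmin
  have mf : Measurable fun t : ℝ => volume {x | ENNReal.ofReal t < f x} :=
    Antitone.measurable fun s t hst => measure_mono fun x hx =>
      lt_of_le_of_lt (ENNReal.ofReal_le_ofReal hst) hx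
  have mg : Measurable fun t : ℝ => volume {x | ENNReal.ofReal t < g x} :=
    Antitone.measurable fun s t hst => measure_mono fun x hx =>
      lt_of_le_of_lt (ENNReal.ofReal_le_ofReal hst) hx
  rw [layer hf hf1, layer hg hg1, layer (hh.min measurable_const) (fun x => min_le_right _ _),
    ← lintegral_const_mul _ mf, ← lintegral_const_mul _ mg, ← lintegral_add_left (mf.const_mul _)]
  refine setLIntegral_mono' measurableSet_Ioo ?_
  intro t ht
  have ht1 : ENNReal.ofReal t < 1 := by simpa using ht.2
  refine bm_scaled (measurableSet_lt measurable_const hf) (measurableSet_lt measurable_const hg)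
    (hf2 _ ht1) (hg2 _ ht1) ha hb ?_
  intro x hx y hy
  simp only [Set.mem_ofPred_eq] at *
  refine lt_min (lt_of_lt_of_le ?_ (H x y)) ht1
  have h0 : ENNReal.ofReal t ≠ 0 := by simpa using ht.1
  calc ENNReal.ofReal t = ENNReal.ofReal t ^ a * ENNReal.ofReal t ^ b := by
        rw [← ENNReal.rpow_add _ _ h0 ENNReal.ofReal_ne_top, hab, ENNReal.rpow_one]
    _ < f x ^ a * g y ^ b := ENNReal.mul_lt_mul (ENNReal.rpow_lt_rpow hx ha)
        (ENNReal.rpow_lt_rpow hy hb)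

lemma pl_one_bdd {f g h : ℝ → ENNReal} (hf : Measurable f) (hg : Measurable g)
    (hh : Measurable h) {a b : ℝ} (ha : 0 < a) (hb : 0 < b) (hab : a + b = 1)
    (M : ENNReal) (hM : M ≠ ⊤)
    (hf1 : ∀ x, f x ≤ M) (hg1 : ∀ x, g x ≤ M)
    (H : ∀ x y, f x ^ a * g y ^ b ≤ h (a * x + b * y)) :
    (∫⁻ x, f x) ^ a * (∫⁻ x, g x) ^ b ≤ ∫⁻ x, h x := by
  set F := ⨆ x, f x with hF
  set G := ⨆ x, g x with hG
  have hFt : F ≠ ⊤ := ((iSup_le hf1).trans_lt hM.lt_top).ne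
  have hGt : G ≠ ⊤ := ((iSup_le hg1).trans_lt hM.lt_top).ne
  by_cases hF0 : F = 0
  · have : ∀ x, f x = 0 := by simpa [hF] using hF0
    simp [this, ha]
  by_cases hG0 : G = 0
  · have : ∀ x, g x = 0 := by simpa [hG] using hG0
    simp [this, hb]
  have hFa0 : F ^ a ≠ 0 := by simp [hF0, hFt]
  have hGb0 : G ^ b ≠ 0 := by simp [hG0, hGt]
  have hFat : F ^ a ≠ ⊤ := ENNReal.rpow_ne_top_of_nonneg ha.le hFt
  have hGbt : G ^ b ≠ ⊤ := ENNReal.rpow_ne_top_of_nonneg hb.le hGt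
  have hinv : (F ^ a * G ^ b)⁻¹ = (F ^ a)⁻¹ * (G ^ b)⁻¹ :=
    ENNReal.mul_inv (Or.inl hFa0) (Or.inl hFat)
  have e : ∀ x y : ENNReal, (x * F⁻¹) ^ a * (y * G⁻¹) ^ b = x ^ a * y ^ b * (F ^ a * G ^ b)⁻¹ := by
    intro x y
    rw [ENNReal.mul_rpow_of_nonneg _ _ ha.le, ENNReal.mul_rpow_of_nonneg _ _ hb.le,
      ENNReal.inv_rpow, ENNReal.inv_rpow, hinv]
    ring
  have key := pl_one_normalized (f := fun x => f x * F⁻¹) (g := fun x => g x * G⁻¹)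
    (h := fun x => h x * (F ^ a * G ^ b)⁻¹) (hf.mul_const _) (hg.mul_const _) (hh.mul_const _)
    ha hb hab
    (fun x => by
      rw [← div_eq_mul_inv]
      exact ENNReal.div_le_of_le_mul (by simpa using le_iSup f x))
    (fun x => by
      rw [← div_eq_mul_inv]
      exact ENNReal.div_le_of_le_mul (by simpa using le_iSup g x))
    (fun t ht => by
      have : t * F < F := by
        simpa using ENNReal.mul_lt_mul_left hF0 hFt ht
      obtain ⟨x, hx⟩ := lt_iSup_iff.1 this
      exact ⟨x, by rw [← div_eq_mul_inv, ENNReal.lt_div_iff_mul_lt (Or.inl hF0) (Or.inl hFt)]; exact hx⟩)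
    (fun t ht => by
      have : t * G < G := by
        simpa using ENNReal.mul_lt_mul_left hG0 hGt ht
      obtain ⟨x, hx⟩ := lt_iSup_iff.1 this
      exact ⟨x, by rw [← div_eq_mul_inv, ENNReal.lt_div_iff_mul_lt (Or.inl hG0) (Or.inl hGt)]; exact hx⟩)
    (fun x y => by
      rw [e]
      gcongr
      exact H x y)
  rw [lintegral_mul_const _ hf, lintegral_mul_const _ hg, lintegral_mul_const _ hh, e] at key
  have c0 : (F ^ a * G ^ b)⁻¹ ≠ 0 := ENNReal.inv_ne_zero.2 (ENNReal.mul_ne_top hFat hGbt)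
  have ct : (F ^ a * G ^ b)⁻¹ ≠ ⊤ := ENNReal.inv_ne_top.2 (mul_ne_zero hFa0 hGb0)
  exact (ENNReal.mul_le_mul_iff_left c0 ct).1 key

lemma pl_one {f g h : ℝ → ENNReal} (hf : Measurable f) (hg : Measurable g)
    (hh : Measurable h) {a b : ℝ} (ha : 0 < a) (hb : 0 < b) (hab : a + b = 1)
    (H : ∀ x y, f x ^ a * g y ^ b ≤ h (a * x + b * y)) :
    (∫⁻ x, f x) ^ a * (∫⁻ x, g x) ^ b ≤ ∫⁻ x, h x := by
  by_cases hF0 : ∫⁻ x, f x = 0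
  · simp [hF0, ha]
  by_cases hG0 : ∫⁻ x, g x = 0
  · simp [hG0, hb]
  have T : ∀ f : ℝ → ENNReal, Measurable f →
      Filter.Tendsto (fun n : ℕ => ∫⁻ x, min (f x) n) Filter.atTop (nhds (∫⁻ x, f x)) := by
    intro f hf
    refine lintegral_tendsto_of_tendsto_of_monotone
      (fun n => (hf.min measurable_const).aemeasurable) (Filter.Eventually.of_forall fun x => ?_)
      (Filter.Eventually.of_forall fun x => ?_)
    · intro m n hmn
      dsimp only
      gcongr
    · have := (tendsto_const_nhds (x := f x)).min ENNReal.tendsto_nat_nhds_top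
      simpa using this
  have T2 := ENNReal.Tendsto.mul (((ENNReal.continuous_rpow_const (y := a)).tendsto _).comp (T f hf))
    (Or.inl (by simp [hF0, ha, ha.not_gt])) (((ENNReal.continuous_rpow_const (y := b)).tendsto _).comp (T g hg))
    (Or.inl (by simp [hG0, hb, hb.not_gt]))
  refine le_of_tendsto' T2 fun n => ?_
  refine pl_one_bdd (hf.min measurable_const) (hg.min measurable_const) hh ha hb hab n (by simp)
    (fun x => min_le_right _ _) (fun x => min_le_right _ _) fun x y => le_trans ?_ (H x y)
  gcongr <;> exact min_le_left _ _

lemma pl {a b : ℝ} (ha : 0 < a) (hb : 0 < b) (hab : a + b = 1) (n : ℕ) :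
    ∀ {f g h : (Fin n → ℝ) → ENNReal} (_ : Measurable f) (_ : Measurable g) (_ : Measurable h)
    (_ : ∀ x y, f x ^ a * g y ^ b ≤ h (a • x + b • y)),
    (∫⁻ x, f x) ^ a * (∫⁻ x, g x) ^ b ≤ ∫⁻ x, h x := by
  induction n with
  | zero =>
    intro f g h hf hg hh H
    rw [lintegral_unique, lintegral_unique, lintegral_unique]
    have hv : volume (Set.univ : Set (Fin 0 → ℝ)) = 1 := by simp [volume_pi]
    rw [hv, mul_one, mul_one, mul_one]
    refine (H _ _).trans_eq ?_
    congr 1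
    exact Subsingleton.elim _ _
  | succ n ih =>
    intro f g h hf hg hh H
    let e := MeasurableEquiv.piFinSuccAbove (fun _ : Fin (n+1) => ℝ) 0
    have he : MeasurePreserving e.symm volume volume :=
      (volume_preserving_piFinSuccAbove (fun _ : Fin (n+1) => ℝ) 0).symm
    have es : ∀ p, e.symm p = Fin.cons p.1 p.2 := fun p => by
      simp [e, MeasurableEquiv.piFinSuccAbove]
      rfl
    have I : ∀ f : (Fin (n+1) → ℝ) → ENNReal, Measurable f →
        ∫⁻ x, f x = ∫⁻ t : ℝ, ∫⁻ z : Fin n → ℝ, f (e.symm (t, z)) := by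
      intro f hf
      rw [← he.lintegral_comp hf]
      exact lintegral_prod _ (hf.comp e.symm.measurable).aemeasurable
    have m : ∀ f : (Fin (n+1) → ℝ) → ENNReal, Measurable f →
        Measurable (fun p : ℝ × (Fin n → ℝ) => f (e.symm p)) := fun f hf =>
      hf.comp e.symm.measurable
    rw [I f hf, I g hg, I h hh]
    refine pl_one (m f hf).lintegral_prod_right' (m g hg).lintegral_prod_right'
      (m h hh).lintegral_prod_right' ha hb hab ?_
    intro s t
    refine ih ((m f hf).comp measurable_prodMk_left) ((m g hg).comp measurable_prodMk_left)
      ((m h hh).comp measurable_prodMk_left) ?_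
    intro x y
    have := H (e.symm (s, x)) (e.symm (t, y))
    refine this.trans_eq ?_
    change _ = h (e.symm _)
    congr 1
    rw [es, es, es]
    ext i
    refine Fin.cases ?_ (fun i => ?_) i <;> simp

lemma bm {n : ℕ} {A B : Set (Fin n → ℝ)} (hA : IsCompact A) (hB : IsCompact B)
    {a b : ℝ} (ha : 0 < a) (hb : 0 < b) (hab : a + b = 1) :
    volume A ^ a * volume B ^ b ≤ volume (a • A + b • B) := by
  have hC : MeasurableSet (a • A + b • B) := ((hA.smul a).add (hB.smul b)).measurableSet
  have := pl ha hb hab n (f := A.indicator 1) (g := B.indicator 1) (h := (a • A + b • B).indicator 1)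
    (measurable_one.indicator hA.measurableSet) (measurable_one.indicator hB.measurableSet)
    (measurable_one.indicator hC) (by
      intro x y
      by_cases hx : x ∈ A
      · by_cases hy : y ∈ B
        · have : a • x + b • y ∈ a • A + b • B :=
            Set.add_mem_add (Set.smul_mem_smul_set hx) (Set.smul_mem_smul_set hy)
          simp [hx, hy, this]
        · simp [hy, hb]
      · simp [hx, ha])
  simpa [lintegral_indicator_one, hA.measurableSet, hB.measurableSet, hC] using this

/-- The pushforward under a surjective linear map `S : ℝⁿ → ℝˢ` of the uniform probability
measure on a compact convex set `K` of positive volume is a log-concave measure: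
`μ (α•A + (1-α)•B) ≥ μ A ^ α * μ B ^ (1-α)` for compact (nonempty) `A`, `B` and `α ∈ [0,1]`. -/
theorem pushforward_uniform_logConcave {n s : ℕ} (hsn : s ≤ n)
    (K : Set (Fin n → ℝ)) (hK : IsCompact K) (hKconv : Convex ℝ K)
    (hKvol : 0 < volume K)
    (S : (Fin n → ℝ) →ₗ[ℝ] (Fin s → ℝ)) (hS : Function.Surjective S)
    (μ : Measure (Fin s → ℝ))
    (hμ : μ = Measure.map S ((volume K)⁻¹ • volume.restrict K)) :
    ∀ A B : Set (Fin s → ℝ), IsCompact A → IsCompact B → A.Nonempty → B.Nonempty →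
      ∀ α : ℝ, α ∈ Set.Icc (0 : ℝ) 1 →
        μ A ^ α * μ B ^ (1 - α) ≤ μ (α • A + (1 - α) • B) := by
  intro A B hA hB hA' hB' α hα
  rcases hα.1.eq_or_lt with rfl | h0
  · simp [Set.zero_smul_set hA']
  rcases hα.2.eq_or_lt with rfl | h1
  · simp [Set.zero_smul_set hB']
  have h1' : 0 < 1 - α := by linarith
  have hSc : Continuous S := S.continuous_of_finiteDimensional
  have hμe : ∀ C, IsCompact C → μ C = (volume K)⁻¹ * volume (K ∩ S ⁻¹' C) := by
    intro C hC
    rw [hμ, Measure.map_apply hSc.measurable hC.measurableSet, Measure.smul_apply,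
      Measure.restrict_apply (hSc.measurable hC.measurableSet), Set.inter_comm, smul_eq_mul]
  have hk0 : (volume K)⁻¹ ≠ 0 := ENNReal.inv_ne_zero.2 hK.measure_lt_top.ne
  have hkt : (volume K)⁻¹ ≠ ⊤ := ENNReal.inv_ne_top.2 hKvol.ne'
  rw [hμe A hA, hμe B hB, hμe _ ((hA.smul α).add (hB.smul (1 - α))),
    ENNReal.mul_rpow_of_nonneg _ _ h0.le, ENNReal.mul_rpow_of_nonneg _ _ h1'.le,
    mul_mul_mul_comm, ← ENNReal.rpow_add _ _ hk0 hkt, add_sub_cancel, ENNReal.rpow_one]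
  gcongr
  refine (bm (hK.inter_right (hA.isClosed.preimage hSc)) (hK.inter_right (hB.isClosed.preimage hSc))
    h0 h1' (by ring)).trans (measure_mono ?_)
  rintro _ ⟨_, ⟨x, hx, rfl⟩, _, ⟨y, hy, rfl⟩, rfl⟩
  refine ⟨hKconv hx.1 hy.1 h0.le h1'.le (by ring), ?_⟩
  simp only [Set.mem_preimage, map_add, map_smul]
  exact Set.add_mem_add (Set.smul_mem_smul_set hx.2) (Set.smul_mem_smul_set hy.2)
end

section
/- The optimal violation function v_o is right-continuous on (0, ∞): for every r₀ > 0, v_o(r) → v_o(r₀) as r decreases to r₀; equivalently, the non-decreasing function φ_o is upper semicontinuous, hence right-continuous, at every r₀ > 0. (Right-continuity part of Theorem 2(iii).) -/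
open MeasureTheory

/-- Right-continuity part of Theorem 2(iii): the optimal violation function
`v_o(r) = inf_z vol {x ∈ K | ‖S x - z‖ > r} / vol K` is right-continuous at every
`r₀ > 0`. -/
theorem optimal_violation_right_continuous {n s : ℕ}
    (K : Set (Fin n → ℝ)) (hK : IsCompact K) (hKconv : Convex ℝ K)
    (hKvol : 0 < volume K)
    (S : (Fin n → ℝ) →ₗ[ℝ] (Fin s → ℝ)) (hS : Function.Surjective S)
    (N : Seminorm ℝ (Fin s → ℝ)) (hN : ∀ v, N v = 0 → v = 0)
    (vo : ℝ → ENNReal)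
    (hvo : ∀ r : ℝ, vo r = ⨅ z : Fin s → ℝ, volume {x ∈ K | r < N (S x - z)} / volume K) :
    ∀ r₀ : ℝ, 0 < r₀ →
      Filter.Tendsto vo (nhdsWithin r₀ (Set.Ioi r₀)) (nhds (vo r₀)) := by
  intro r₀ _
  have hNc : Continuous N :=
    continuousOn_univ.1 (ConvexOn.continuousOn isOpen_univ N.convexOn)
  have hSc : Continuous S := S.continuous_of_finiteDimensional
  -- N dominates the norm
  obtain ⟨c, hc0, hc⟩ : ∃ c : ℝ, 0 < c ∧ ∀ z, c * ‖z‖ ≤ N z := by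
    obtain ⟨c, hc0, hc⟩ := (isCompact_sphere (0 : Fin s → ℝ) 1).exists_forall_le'
      (f := N) hNc.continuousOn (a := 0) (by
        intro b hb
        refine lt_of_le_of_ne (apply_nonneg N b) fun h => ?_
        have := hN b h.symm
        simp [this] at hb)
    refine ⟨c, hc0, fun z => ?_⟩
    by_cases hz : z = 0
    · simp [hz]
    have hz' : 0 < ‖z‖ := norm_pos_iff.2 hz
    have h1 := hc (‖z‖⁻¹ • z) (by simp [norm_smul, hz'.ne'])
    rw [map_smul_eq_mul, norm_inv, norm_norm, inv_mul_eq_div, le_div_iff₀ hz'] at h1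
    exact h1
  obtain ⟨M, hM⟩ : ∃ M : ℝ, ∀ x ∈ K, N (S x) ≤ M := by
    obtain ⟨M, hM⟩ := (hK.image (hNc.comp hSc)).bddAbove
    exact ⟨M, fun x hx => hM ⟨x, hx, rfl⟩⟩
  -- lower semicontinuity
  have lsc : ∀ (a : ENNReal) (z : Fin s → ℝ),
      a < volume {x ∈ K | r₀ < N (S x - z)} / volume K →
      ∀ᶠ p : ℝ × (Fin s → ℝ) in nhds (r₀, z),
        a < volume {x ∈ K | p.1 < N (S x - p.2)} / volume K := by
    intro a z ha
    have hU : {x ∈ K | r₀ < N (S x - z)} =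
        ⋃ m : ℕ, {x ∈ K | r₀ + 1 / ((m : ℝ) + 1) < N (S x - z)} := by
      ext x
      simp only [Set.mem_ofPred_eq, Set.mem_iUnion]
      constructor
      · rintro ⟨hx, h⟩
        obtain ⟨m, hm⟩ := exists_nat_one_div_lt (sub_pos.2 h)
        exact ⟨m, hx, by linarith⟩
      · rintro ⟨m, hx, h⟩
        have : (0 : ℝ) < 1 / ((m : ℝ) + 1) := by positivity
        exact ⟨hx, by linarith⟩
    have hmono : Monotone fun m : ℕ => {x ∈ K | r₀ + 1 / ((m : ℝ) + 1) < N (S x - z)} := by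
      rintro m k hmk x ⟨hx, h⟩
      have := Nat.one_div_le_one_div (α := ℝ) hmk
      exact ⟨hx, by linarith⟩
    rw [hU, hmono.measure_iUnion, ENNReal.iSup_div, lt_iSup_iff] at ha
    obtain ⟨m, hm⟩ := ha
    have hcont : Continuous fun p : ℝ × (Fin s → ℝ) => p.1 + N (p.2 - z) := by fun_prop
    have hlt : (fun p : ℝ × (Fin s → ℝ) => p.1 + N (p.2 - z)) (r₀, z)
        < r₀ + 1 / ((m : ℝ) + 1) := by
      have : (0 : ℝ) < 1 / ((m : ℝ) + 1) := by positivity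
      simp only [sub_self, map_zero]
      linarith
    filter_upwards [hcont.continuousAt.eventually_lt continuousAt_const hlt] with p hp
    refine hm.trans_le (ENNReal.div_le_div_right (measure_mono ?_) _)
    rintro x ⟨hx, h⟩
    have h2 := map_add_le_add N (S x - p.2) (p.2 - z)
    rw [sub_add_sub_cancel] at h2
    exact ⟨hx, by linarith⟩
  rw [tendsto_order]
  constructor
  · intro a ha
    obtain ⟨b, hab, hb⟩ := exists_between ha
    have hB := isCompact_closedBall (0 : Fin s → ℝ) ((M + r₀ + 1) / c)
    have key : ∀ᶠ r in nhds r₀, ∀ z ∈ Metric.closedBall (0 : Fin s → ℝ) ((M + r₀ + 1) / c),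
        b < volume {x ∈ K | r < N (S x - z)} / volume K := by
      refine hB.eventually_forall_of_forall_eventually fun z _ => ?_
      refine lsc b z (hb.trans_le ?_)
      rw [hvo]
      exact iInf_le _ z
    have hr1 : ∀ᶠ r in nhds r₀, r < r₀ + 1 := eventually_lt_nhds (by linarith)
    filter_upwards [nhdsWithin_le_nhds key, nhdsWithin_le_nhds hr1] with r hr hr1
    refine hab.trans_le ?_
    rw [hvo]
    refine le_iInf fun z => ?_
    by_cases hz : z ∈ Metric.closedBall (0 : Fin s → ℝ) ((M + r₀ + 1) / c)
    · exact (hr z hz).le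
    · refine hb.le.trans ?_
      rw [hvo]
      refine (iInf_le _ z).trans (ENNReal.div_le_div_right (measure_mono ?_) _)
      rintro x ⟨hx, -⟩
      refine ⟨hx, ?_⟩
      rw [mem_closedBall_zero_iff, not_le, div_lt_iff₀ hc0] at hz
      have h1 := hc z
      have h2 := hM x hx
      have h3 := map_sub_le_add N (S x) (S x - z)
      rw [sub_sub_cancel] at h3
      linarith
  · intro a ha
    filter_upwards [self_mem_nhdsWithin] with r hr
    refine lt_of_le_of_lt ?_ ha
    rw [hvo, hvo]
    refine iInf_mono fun z => ENNReal.div_le_div_right (measure_mono ?_) _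
    rintro x ⟨hx, h⟩
    exact ⟨hx, lt_trans hr h⟩
end

section
/- For every accuracy level ε ∈ (0,1), the set {r > 0 : v_o(r) ≤ ε} is nonempty, and its infimum r^pr(ε) = inf{r > 0 : v_o(r) ≤ ε} is attained, i.e. v_o(r^pr(ε)) ≤ ε. (Well-posedness of the inverse problem defining the probabilistic radius of information, guaranteed by right-continuity and monotonicity of v_o.) -/
open MeasureTheory

/-- Well-posedness of the inverse problem defining the probabilistic radius of
information: for every `ε ∈ (0,1)`, the set `{r > 0 : v_o(r) ≤ ε}` is nonempty and its
infimum `r^pr(ε)` satisfies `v_o(r^pr(ε)) ≤ ε`. -/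
theorem probabilistic_radius_wellposed {n s : ℕ}
    (K : Set (Fin n → ℝ)) (hK : IsCompact K) (hKconv : Convex ℝ K)
    (hKvol : 0 < volume K)
    (S : (Fin n → ℝ) →ₗ[ℝ] (Fin s → ℝ)) (hS : Function.Surjective S)
    (N : Seminorm ℝ (Fin s → ℝ)) (hN : ∀ v, N v = 0 → v = 0)
    (vo : ℝ → ENNReal)
    (hvo : ∀ r : ℝ, vo r = ⨅ z : Fin s → ℝ, volume {x ∈ K | r < N (S x - z)} / volume K)
    (ε : ℝ) (hε : ε ∈ Set.Ioo (0 : ℝ) 1) :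
    {r : ℝ | 0 < r ∧ vo r ≤ ENNReal.ofReal ε}.Nonempty ∧
      vo (sInf {r : ℝ | 0 < r ∧ vo r ≤ ENNReal.ofReal ε}) ≤ ENNReal.ofReal ε := by
  obtain ⟨hε0, hε1⟩ := hε
  have hNc : Continuous N := by
    rw [← continuousOn_univ]
    exact N.convexOn.continuousOn isOpen_univ
  have hSc : Continuous S := S.continuous_of_finiteDimensional
  have hKtop : volume K ≠ ⊤ := hK.measure_lt_top.ne
  have hK0 : volume K ≠ 0 := hKvol.ne'
  obtain ⟨R, hR⟩ : ∃ R : ℝ, ∀ x ∈ K, N (S x) ≤ R := by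
    obtain ⟨R, hR⟩ := (hK.image (hNc.comp hSc)).bddAbove
    exact ⟨R, fun x hx => hR ⟨x, hx, rfl⟩⟩
  -- the norm dominates a multiple of the sup norm
  obtain ⟨c, hc, hcN⟩ : ∃ c : ℝ, 0 < c ∧ ∀ v, c * ‖v‖ ≤ N v := by
    rcases (Metric.sphere (0 : Fin s → ℝ) 1).eq_empty_or_nonempty with he | hne
    · refine ⟨1, one_pos, fun v => ?_⟩
      by_cases hv : v = 0
      · simp [hv]
      · exfalso
        have : (‖v‖⁻¹ • v) ∈ Metric.sphere (0 : Fin s → ℝ) 1 := by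
          simp [norm_smul, hv]
        rw [he] at this
        exact this
    · obtain ⟨u, hu, hmin⟩ := (isCompact_sphere (0 : Fin s → ℝ) 1).exists_isMinOn hne
        hNc.continuousOn
      have hu0 : N u ≠ 0 := by
        intro h
        have := hN u h
        simp [this] at hu
      refine ⟨N u, lt_of_le_of_ne (apply_nonneg N u) hu0.symm, fun v => ?_⟩
      by_cases hv : v = 0
      · simp [hv]
      · have hm : (‖v‖⁻¹ • v) ∈ Metric.sphere (0 : Fin s → ℝ) 1 := by
          simp [norm_smul, hv]
        have h1 : N u ≤ N (‖v‖⁻¹ • v) := hmin hm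
        rw [map_smul_eq_mul, norm_inv, norm_norm] at h1
        have hp : 0 < ‖v‖ := norm_pos_iff.mpr hv
        rw [inv_mul_eq_div, le_div_iff₀ hp] at h1
        exact h1
  have hmono : ∀ r r' : ℝ, r ≤ r' → vo r' ≤ vo r := by
    intro r r' h
    rw [hvo, hvo]
    refine iInf_mono fun z => ?_
    refine ENNReal.div_le_div_right (measure_mono ?_) _
    intro x hx
    exact ⟨hx.1, h.trans_lt hx.2⟩
  have hne : {r : ℝ | 0 < r ∧ vo r ≤ ENNReal.ofReal ε}.Nonempty := by
    refine ⟨max R 0 + 1, by positivity, ?_⟩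
    rw [hvo]
    refine (iInf_le _ 0).trans ?_
    have : {x ∈ K | max R 0 + 1 < N (S x - 0)} = ∅ := by
      ext x
      simp only [Set.mem_ofPred_eq, Set.mem_empty_iff_false, iff_false, not_and, not_lt, sub_zero]
      intro hx
      linarith [hR x hx, le_max_left R 0]
    rw [this]
    simp
  refine ⟨hne, ?_⟩
  set r0 := sInf {r : ℝ | 0 < r ∧ vo r ≤ ENNReal.ofReal ε} with hr0
  have hright : ∀ r, r0 < r → vo r ≤ ENNReal.ofReal ε := by
    intro r hr
    obtain ⟨a, ha, har⟩ := exists_lt_of_csInf_lt hne hr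
    exact (hmono _ _ har.le).trans ha.2
  let e : ℕ → ℝ := fun k => ε + (1 - ε) / 2 * (1 / ((k : ℝ) + 1))
  have hpos : ∀ k : ℕ, 0 < 1 / ((k : ℝ) + 1) := fun k => by positivity
  have hle1 : ∀ k : ℕ, 1 / ((k : ℝ) + 1) ≤ 1 := fun k => by
    rw [div_le_one (by positivity)]
    linarith [(Nat.cast_nonneg k : (0 : ℝ) ≤ k)]
  have hlim : Filter.Tendsto (fun k : ℕ => 1 / ((k : ℝ) + 1)) Filter.atTop (nhds 0) :=
    tendsto_one_div_add_atTop_nhds_zero_nat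
  have hz : ∀ k : ℕ, ∃ z : Fin s → ℝ,
      volume {x ∈ K | r0 + 1 / ((k : ℝ) + 1) < N (S x - z)} / volume K < ENNReal.ofReal (e k) := by
    intro k
    have h1 := hright (r0 + 1 / ((k : ℝ) + 1)) (by linarith [hpos k])
    have h2 : ENNReal.ofReal ε < ENNReal.ofReal (e k) := by
      have : ε < e k := by
        have := mul_pos (show 0 < (1 - ε) / 2 by linarith) (hpos k)
        simp only [e]
        linarith
      exact (ENNReal.ofReal_lt_ofReal_iff (hε0.trans this)).2 this
    have h3 := h1.trans_lt h2
    rw [hvo] at h3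
    exact iInf_lt_iff.1 h3
  choose z hz using hz
  have hzb : ∀ k, z k ∈ Metric.closedBall (0 : Fin s → ℝ) ((R + r0 + 1) / c) := by
    intro k
    have hx : ∃ x ∈ K, N (S x - z k) ≤ r0 + 1 / ((k : ℝ) + 1) := by
      by_contra! hcon
      have hs : {x ∈ K | r0 + 1 / ((k : ℝ) + 1) < N (S x - z k)} = K := by
        ext x
        exact ⟨fun h => h.1, fun h => ⟨h, hcon x h⟩⟩
      have h1 := hz k
      rw [hs, ENNReal.div_self hK0 hKtop] at h1
      have h2 : e k ≤ 1 := by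
        have := mul_le_mul_of_nonneg_left (hle1 k) (show 0 ≤ (1 - ε) / 2 by linarith)
        simp only [e]
        linarith
      have h3 : ENNReal.ofReal (e k) ≤ 1 := ENNReal.ofReal_le_one.2 h2
      exact absurd h1 (not_lt.2 h3)
    obtain ⟨x, hxK, hx⟩ := hx
    have h1 : N (z k) ≤ N (S x) + N (S x - z k) := by
      have := map_sub_le_add N (S x) (S x - z k)
      rwa [sub_sub_cancel] at this
    rw [mem_closedBall_zero_iff, le_div_iff₀ hc]
    linarith [hcN (z k), hR x hxK, hle1 k]
  obtain ⟨w, -, φ, hφ, hw⟩ := (isCompact_closedBall (0 : Fin s → ℝ) ((R + r0 + 1) / c)).tendsto_subseq hzb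
  rw [hvo]
  refine (iInf_le _ w).trans ?_
  have hA : ∀ m : ℕ, volume {x ∈ K | r0 + 1 / ((m : ℝ) + 1) < N (S x - w)} / volume K
      ≤ ENNReal.ofReal ε := by
    intro m
    have hlimφ := hlim.comp hφ.tendsto_atTop
    have he : Filter.Tendsto (fun k => ENNReal.ofReal (e (φ k))) Filter.atTop
        (nhds (ENNReal.ofReal ε)) := by
      apply ENNReal.tendsto_ofReal
      have := (hlimφ.const_mul ((1 - ε) / 2)).const_add ε
      simpa [e, Function.comp_def] using this
    refine ge_of_tendsto he ?_
    have hd : Filter.Tendsto (fun k => 1 / ((φ k : ℝ) + 1) + N (z (φ k) - w)) Filter.atTop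
        (nhds 0) := by
      have h1 : Filter.Tendsto (fun k => N (z (φ k) - w)) Filter.atTop (nhds (N (w - w))) :=
        (hNc.tendsto _).comp (hw.sub_const w)
      rw [sub_self, map_zero] at h1
      simpa [Function.comp_def] using hlimφ.add h1
    filter_upwards [hd.eventually_lt_const (hpos m)] with k hk
    refine le_trans ?_ (hz (φ k)).le
    refine ENNReal.div_le_div_right (measure_mono ?_) _
    intro x hx
    refine ⟨hx.1, ?_⟩
    have h1 : N (S x - w) ≤ N (S x - z (φ k)) + N (z (φ k) - w) := by
      have := map_add_le_add N (S x - z (φ k)) (z (φ k) - w)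
      rwa [sub_add_sub_cancel] at this
    have h2 := hx.2
    linarith
  have hU : {x ∈ K | r0 < N (S x - w)} =
      ⋃ m : ℕ, {x ∈ K | r0 + 1 / ((m : ℝ) + 1) < N (S x - w)} := by
    ext x
    simp only [Set.mem_iUnion, Set.mem_ofPred_eq]
    constructor
    · rintro ⟨hx, h⟩
      obtain ⟨m, hm⟩ := exists_nat_one_div_lt (sub_pos.2 h)
      exact ⟨m, hx, by linarith⟩
    · rintro ⟨m, hx, h⟩
      exact ⟨hx, by linarith [hpos m]⟩
  have hM : Monotone fun m : ℕ => {x ∈ K | r0 + 1 / ((m : ℝ) + 1) < N (S x - w)} := by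
    intro m m' h x hx
    refine ⟨hx.1, lt_of_le_of_lt ?_ hx.2⟩
    have := Nat.one_div_le_one_div (α := ℝ) h
    linarith
  rw [hU, hM.measure_iUnion, ENNReal.iSup_div]
  exact iSup_le hA
end

section
/- Let I be a real m×n matrix, y ∈ ℝᵐ, ρ > 0, P a real n×n matrix and x_E ∈ ℝⁿ. The ellipsoid ℰ(x_E, P) = {x_E + P w : ‖w‖₂ ≤ 1} is contained in the ℓ∞ consistency set {x ∈ ℝⁿ : ‖I x − y‖_∞ ≤ ρ} if and only if for every i = 1, …, m one has ‖Pᵀ Iᵀ e_i‖₂ ≤ ρ − |(I x_E − y)_i|, where e_i is the i-th standard basis vector of ℝᵐ. (Characterization of the constraints (I1)–(I2) of Theorem 3.) -/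
open Matrix

lemma slab_aux {n : ℕ} (g : Fin n → ℝ) (c ρ : ℝ) :
    (∀ w : Fin n → ℝ, Real.sqrt (∑ i, w i ^ 2) ≤ 1 → |c + g ⬝ᵥ w| ≤ ρ) ↔
      Real.sqrt (∑ j, g j ^ 2) ≤ ρ - |c| := by
  have hnn : 0 ≤ ∑ j, g j ^ 2 := Finset.sum_nonneg fun _ _ => sq_nonneg _
  constructor
  · intro h
    set s := Real.sqrt (∑ j, g j ^ 2) with hs
    have hs2 : ∑ j, g j ^ 2 = s ^ 2 := (Real.sq_sqrt hnn).symm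
    have key : ∀ t : ℝ, t ^ 2 = 1 → |c + t * s| ≤ ρ := by
      intro t ht
      have h1 := h (fun j => t * s⁻¹ * g j) (by
        simp only [mul_pow, ← Finset.mul_sum, hs2, ht, one_mul]
        rw [Real.sqrt_le_iff]
        refine ⟨zero_le_one, ?_⟩
        by_cases h0 : s = 0
        · simp [h0]
        · field_simp
          norm_num)
      have h2 : g ⬝ᵥ (fun j => t * s⁻¹ * g j) = t * s := by
        have : g ⬝ᵥ (fun j => t * s⁻¹ * g j) = t * s⁻¹ * ∑ j, g j ^ 2 := by
          rw [Finset.mul_sum]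
          exact Finset.sum_congr rfl fun j _ => by ring
        rw [this, hs2]
        by_cases h0 : s = 0
        · simp [h0]
        · field_simp
      rwa [h2] at h1
    have ha := abs_le.1 (key 1 (by norm_num))
    have hb := abs_le.1 (key (-1) (by norm_num))
    rcases abs_cases c with hc | hc <;> linarith
  · intro h w hw
    have h1 : |g ⬝ᵥ w| ≤ Real.sqrt (∑ j, g j ^ 2) := by
      have e1 := Finset.sum_mul_sq_le_sq_mul_sq Finset.univ g w
      have hw := (Real.sqrt_le_iff.1 hw).2
      rw [one_pow] at hw
      apply Real.abs_le_sqrt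
      exact e1.trans (mul_le_of_le_one_right hnn hw)
    linarith [abs_add_le c (g ⬝ᵥ w)]

/-- Characterization of constraints (I1)-(I2) of Theorem 3: the ellipsoid
`ℰ(x_E, P)` is contained in the ℓ∞ consistency set `{x : ‖A x - y‖_∞ ≤ ρ}` if and only
if `‖Pᵀ Aᵀ e_i‖₂ ≤ ρ - |(A x_E - y)_i|` for every row index `i`. -/
theorem ellipsoid_subset_consistency_iff {m n : ℕ} (A : Matrix (Fin m) (Fin n) ℝ)
    (y : Fin m → ℝ) (ρ : ℝ) (hρ : 0 < ρ) (P : Matrix (Fin n) (Fin n) ℝ)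
    (xE : Fin n → ℝ) :
    {x : Fin n → ℝ | ∃ w : Fin n → ℝ, Real.sqrt (∑ i, w i ^ 2) ≤ 1 ∧ x = xE + P.mulVec w} ⊆
        {x : Fin n → ℝ | ‖A.mulVec x - y‖ ≤ ρ} ↔
      ∀ i : Fin m,
        Real.sqrt (∑ j, (Pᵀ.mulVec (Aᵀ.mulVec (Pi.single i 1))) j ^ 2) ≤
          ρ - |(A.mulVec xE - y) i| := by
  have hval : ∀ (w : Fin n → ℝ) (i : Fin m), (A.mulVec (xE + P.mulVec w) - y) i =
      (A.mulVec xE - y) i + (Pᵀ.mulVec (Aᵀ.mulVec (Pi.single i 1))) ⬝ᵥ w := by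
    intro w i
    rw [Matrix.mulVec_transpose, ← Matrix.dotProduct_mulVec, Matrix.mulVec_transpose,
      ← Matrix.dotProduct_mulVec, single_one_dotProduct, Matrix.mulVec_add]
    simp only [Pi.add_apply, Pi.sub_apply]
    ring
  simp only [← slab_aux]
  constructor
  · intro h i w hw
    have h1 : ‖A.mulVec (xE + P.mulVec w) - y‖ ≤ ρ := h ⟨w, hw, rfl⟩
    rw [← hval, ← Real.norm_eq_abs]
    exact (norm_le_pi_norm _ i).trans h1
  · rintro h x ⟨w, hw, rfl⟩
    refine (pi_norm_le_iff_of_nonneg hρ.le).2 fun i => ?_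
    rw [hval, Real.norm_eq_abs]
    exact h i w hw
end
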